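/- arXiv:0905.2355 — 2 statements merged into one kernel-verified Lean document; each statement's English description precedes it below -/
import Mathlib

section
/- Let A = (Q, Σ, δ, S) be an automaton (Q a set of states, Σ a set of action labels, δ ⊆ Q × Σ × Q a set of named transitions where each transition has a unique name p_k, S ⊆ Q a nonempty set of start states), and let Â = (Q̂, Σ̂, δ̂, Ŝ) be a constraint meta-automaton over A, i.e., an automaton whose alphabet Σ̂ is the set of transition names of δ. Let A' = A ⃗· Â be the meta-composition, with state set Q × Q̂, alphabet Σ, start states S × Ŝ, and transitions δ' defined by: ((q_i, q̂_j), a, (q_m, q̂_n)) ∈ δ' with name p_k iff the transition named p_k equals (q_i, a, q_m) ∈ δ and (q̂_j, p_k, q̂_n) ∈ δ̂. Then for every finite word t over Σ: t is an execution trace of A' (i.e., there is a run of A' from a start state whose sequence of action labels is t) if and only if there is a run of A from a start state whose sequence of action labels is t and whose corresponding sequence of transition names t_δ is an execution trace of Â (i.e., there is a run of Â from a start state whose sequence of labels is t_δ). -/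
/-- A run of a labeled transition system given as a set of labeled transitions:
`Run d q w q'` means there is a path from `q` to `q'` whose sequence of labels is `w`. -/
inductive Run {Q A : Type*} (d : Set (Q × A × Q)) : Q → List A → Q → Prop
  | nil (q : Q) : Run d q [] q
  | cons {q q' q'' : Q} {a : A} {w : List A} :
      (q, a, q') ∈ d → Run d q' w q'' → Run d q (a :: w) q''

/-- The transitions of an automaton whose transitions are uniquely named,
given by `tr : N → Q × A × Q` (the name `n` denotes the transition `tr n`),
viewed as a transition system whose labels are the transition names:
name `n` leads from `q` to `q'` iff `tr n = (q, a, q')` for some action `a`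
(namely `a = (tr n).2.1`). -/
def nameStep {Q A N : Type*} (tr : N → Q × A × Q) : Set (Q × N × Q) :=
  { x | tr x.2.1 = (x.1, (tr x.2.1).2.1, x.2.2) }

/-- The transitions of the meta-composition `A ⃗· Â`: the transition named `n`
from `(qᵢ, q̂ⱼ)` to `(qₘ, q̂ₙ)` labeled `a` exists iff `tr n = (qᵢ, a, qₘ)`
(i.e. the `A`-transition named `n` is `(qᵢ, a, qₘ)`) and `(q̂ⱼ, n, q̂ₙ) ∈ δ̂`. -/
def metaStep {Q A N QHat : Type*} (tr : N → Q × A × Q)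
    (dHat : Set (QHat × N × QHat)) : Set ((Q × QHat) × A × (Q × QHat)) :=
  { x | ∃ n : N, tr n = (x.1.1, x.2.1, x.2.2.1) ∧ (x.1.2, n, x.2.2.2) ∈ dHat }

/-- A run of the meta-composition is a run of the automaton together with a run of the
constraint meta-automaton over the same sequence of transition names. -/
theorem run_metaStep_iff {Q A N QHat : Type*} (tr : N → Q × A × Q)
    (dHat : Set (QHat × N × QHat)) (p e : Q × QHat) (t : List A) :
    Run (metaStep tr dHat) p t e ↔
      ∃ ns : List N, Run (nameStep tr) p.1 ns e.1 ∧
        ns.map (fun n => (tr n).2.1) = t ∧ Run dHat p.2 ns e.2 := by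
  constructor
  · intro h
    induction h with
    | nil q => exact ⟨[], .nil _, rfl, .nil _⟩
    | cons hstep _ ih =>
      obtain ⟨n, htr, hd⟩ := hstep
      obtain ⟨ns, hrun, hmap, hrunHat⟩ := ih
      dsimp only at htr hd
      exact ⟨n :: ns, .cons (show tr n = _ by simp [htr]) hrun, by simp [htr, hmap],
        .cons hd hrunHat⟩
  · rintro ⟨ns, hrun, rfl, hrunHat⟩
    obtain ⟨q, qHat⟩ := p
    obtain ⟨r, rHat⟩ := e
    dsimp only at hrun hrunHat
    induction hrun generalizing qHat with
    | nil q =>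
      cases hrunHat
      exact .nil _
    | cons hstep _ ih =>
      cases hrunHat with
      | cons hd hrunHat => exact .cons (q' := (_, _)) ⟨_, hstep, hd⟩ (ih _ hrunHat)

/-- **Theorem (traces of the meta-composition).**
Let `A = (Q, Σ, δ, S)` be an automaton with uniquely named transitions
(`tr : N → Q × A × Q`, `S` nonempty), and `Â = (Q̂, Σ̂ = N, δ̂, Ŝ)` a constraint
meta-automaton over `A` (`Ŝ` nonempty), and `A' = A ⃗· Â` their meta-composition
(states `Q × Q̂`, alphabet `Σ`, start states `S × Ŝ`, transitions `metaStep`).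
Then a finite word `t` over `Σ` is an execution trace of `A'` iff there is a run
of `A` from a start state whose sequence of action labels is `t` and whose
sequence of transition names is an execution trace of `Â`. -/
theorem metaComposition_trace_iff {Q A N QHat : Type*}
    (tr : N → Q × A × Q) (S : Set Q) (hS : S.Nonempty)
    (dHat : Set (QHat × N × QHat)) (SHat : Set QHat) (hSHat : SHat.Nonempty)
    (t : List A) :
    (∃ s ∈ S ×ˢ SHat, ∃ e, Run (metaStep tr dHat) s t e) ↔
      (∃ s ∈ S, ∃ ns : List N, ∃ e,
        Run (nameStep tr) s ns e ∧
        ns.map (fun n => (tr n).2.1) = t ∧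
        ∃ sh ∈ SHat, ∃ eh, Run dHat sh ns eh) := by
  simp only [run_metaStep_iff]
  constructor
  · rintro ⟨s, hs, e, ns, hrun, hmap, hrunHat⟩
    exact ⟨s.1, hs.1, ns, e.1, hrun, hmap, s.2, hs.2, e.2, hrunHat⟩
  · rintro ⟨s, hs, ns, e, hrun, hmap, sh, hsh, eh, hrunHat⟩
    exact ⟨(s, sh), ⟨hs, hsh⟩, (e, eh), ns, hrun, hmap, hrunHat⟩
end

section
/- Let A = Π_{n ∈ N} A_n be the composition of a finite collection of strongly compatible I/O automata, with composite transitions named by sets p_I of component-transition names, and let Â be a constraint meta-automaton over A whose alphabet is the set of component transition names. Let A' = A ⃗· Â be the multi-component meta-composition, whose transitions are: a transition named p_I from ((q⃗_i, q̂_j)) to ((q⃗_m, q̂_n)) labeled a exists iff the transition named p_I from q⃗_i to q⃗_m labeled a is in δ, and there exists k ∈ I with (q̂_j, p_k, q̂_n) ∈ δ̂. Then L(A') ⊆ L(A): every execution trace (finite word over the action alphabet labeling a run from a start state) of A' is an execution trace of A. -/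
/-- Synchronized transition of the composition `Π_n A_n` of I/O automata with
named component transitions `tr i : Nm i → Qf i × Act × Qf i` and alphabets
`alph i`. `CompStep alph tr q I a q'` says that the composition has a transition
from the state vector `q` to `q'` labeled `a`, named by the set `I` of names of
the participating component transitions: every component `j` whose alphabet
contains `a` takes a matching transition whose name belongs to `I`, and every
other component stays unchanged and contributes no name to `I`. -/
def CompStep {ι Act : Type*} {Qf : ι → Type*} {Nm : ι → Type*}
    (alph : ι → Set Act) (tr : ∀ i, Nm i → Qf i × Act × Qf i)
    (q : ∀ i, Qf i) (I : Set (Σ i, Nm i)) (a : Act) (q' : ∀ i, Qf i) : Prop :=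
  ∀ j, (a ∈ alph j →
          ∃ n : Nm j, (⟨j, n⟩ : Σ i, Nm i) ∈ I ∧ tr j n = (q j, a, q' j)) ∧
       (a ∉ alph j → q j = q' j ∧ ∀ n : Nm j, (⟨j, n⟩ : Σ i, Nm i) ∉ I)

/-- A map of states that preserves labeled transitions sends runs to runs with the same labels. -/
theorem Run.map {Q Q' A : Type*} {d : Set (Q × A × Q)} {d' : Set (Q' × A × Q')} (f : Q → Q')
    (hf : ∀ q a q', (q, a, q') ∈ d → (f q, a, f q') ∈ d') {q q' : Q} {w : List A}
    (h : Run d q w q') : Run d' (f q) w (f q') := by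
  induction h with
  | nil q => exact .nil _
  | cons hd _ ih => exact .cons (hf _ _ _ hd) ih

/-- **Theorem (`L(A') ⊆ L(A)` for the multi-component meta-composition).**
Let `A = Π_{n ∈ ι} A_n` (`ι` finite) be the composition of a collection of
strongly compatible, input-enabled I/O automata whose transitions are uniquely
named (`tr i : Nm i → Qf i × Act × Qf i`), the composite transitions being named
by sets `I` of component-transition names. Let `Â = (Q̂, Σ̂, δ̂, Ŝ)` be a
constraint meta-automaton over `A` whose alphabet `Σ̂` is the set `Σ i, Nm i` of
component transition names, and let `A' = A ⃗· Â` be the multi-component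
meta-composition: a transition named `I` from `(q⃗, q̂)` to `(q⃗', q̂')` labeled
`a` exists iff the composite transition named `I` from `q⃗` to `q⃗'` labeled `a`
exists and there is some `k ∈ I` with `(q̂, k, q̂') ∈ δ̂`.
Then `L(A') ⊆ L(A)`: every execution trace of `A'` (finite word over the action
alphabet labeling a run from a start state) is an execution trace of `A`. -/
theorem multi_metaComposition_language_subset {ι Act QHat : Type*} [Fintype ι]
    {Qf : ι → Type*} {Nm : ι → Type*}
    (In Out Hid : ι → Set Act)
    (tr : ∀ i, Nm i → Qf i × Act × Qf i)
    (S : ∀ i, Set (Qf i)) (hS : ∀ i, (S i).Nonempty)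
    (hdisjIO : ∀ i, Disjoint (In i) (Out i))
    (hdisjIH : ∀ i, Disjoint (In i) (Hid i))
    (hdisjOH : ∀ i, Disjoint (Out i) (Hid i))
    (hIE : ∀ i, ∀ a ∈ In i, ∀ q : Qf i,
      ∃ n : Nm i, (tr i n).1 = q ∧ (tr i n).2.1 = a)
    (hcompatO : ∀ i j, i ≠ j → Disjoint (Out i) (Out j))
    (hcompatH : ∀ i j, i ≠ j → Disjoint (Hid i) (In j ∪ Out j ∪ Hid j))
    (dHat : Set (QHat × (Σ i, Nm i) × QHat))
    (SHat : Set QHat) (hSHat : SHat.Nonempty) :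
    { w : List Act |
      ∃ s ∈ ({q : ∀ i, Qf i | ∀ i, q i ∈ S i} ×ˢ SHat), ∃ e,
        Run { x : ((∀ i, Qf i) × QHat) × Act × ((∀ i, Qf i) × QHat) |
              ∃ I : Set (Σ i, Nm i),
                CompStep (fun i => In i ∪ Out i ∪ Hid i) tr
                  x.1.1 I x.2.1 x.2.2.1 ∧
                ∃ k ∈ I, (x.1.2, k, x.2.2.2) ∈ dHat } s w e } ⊆
    { w : List Act |
      ∃ s ∈ {q : ∀ i, Qf i | ∀ i, q i ∈ S i}, ∃ e,
        Run { x : (∀ i, Qf i) × Act × (∀ i, Qf i) |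
              ∃ I : Set (Σ i, Nm i),
                CompStep (fun i => In i ∪ Out i ∪ Hid i) tr
                  x.1 I x.2.1 x.2.2 } s w e } := by
  rintro w ⟨s, hs, e, hrun⟩
  refine ⟨s.1, hs.1, e.1, hrun.map Prod.fst ?_⟩
  rintro q a q' ⟨I, hI, -⟩
  exact ⟨I, hI⟩
end
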